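/- arXiv:2308.07088 — 2 statements merged into one kernel-verified Lean document; each statement's English description precedes it below -/
import Mathlib

section
/- Let p₀, p₁, …, pₙ be nonnegative reals summing to 1 with p₀ < 1, let x₁, …, xₙ ∈ ℝᵏ and x̂ ∈ ℝᵏ, and set X₀ = ∅ and Xᵢ = {xᵢ} for i ≥ 1. Define wᵢ = pᵢ/(1 − p₀) for i ≥ 1, and w̲ᵢ = wᵢ if ‖xᵢ − x̂‖ ≤ c and w̲ᵢ = 0 otherwise. Then the mean squared GOSPA error of the point estimate {x̂} satisfies ∑_{i=0}^{n} pᵢ · [d₂^{(c,2)}(Xᵢ, {x̂})]² = (c²/2)·p₀ + (1 − p₀)·( ∑_{i=1}^{n} w̲ᵢ·‖xᵢ − x̂‖² + c²·(1 − ∑_{i=1}^{n} w̲ᵢ) ). -/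
/-- The GOSPA metric (p = 2, α = 2, cutoff `c`) between the finite sets of points
`{x 0, …, x (n-1)}` and `{y 0, …, y (m-1)}` in `ℝᵏ`: the minimum over assignment sets
`γ ⊆ {1,…,n} × {1,…,m}` (in which every left index and every right index appears in at
most one pair) of
`( ∑_{(i,j) ∈ γ} ‖x i − y j‖² + (c²/2)(n − |γ| + m − |γ|) )^{1/2}`. -/
noncomputable def gospa {k n m : ℕ} (c : ℝ)
    (x : Fin n → EuclideanSpace ℝ (Fin k)) (y : Fin m → EuclideanSpace ℝ (Fin k)) : ℝ :=
  sInf {d : ℝ | ∃ γ : Finset (Fin n × Fin m),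
    ((∀ p ∈ γ, ∀ q ∈ γ, p.1 = q.1 → p.2 = q.2) ∧
     (∀ p ∈ γ, ∀ q ∈ γ, p.2 = q.2 → p.1 = q.1)) ∧
    d = Real.sqrt ((∑ p ∈ γ, ‖x p.1 - y p.2‖ ^ 2) +
        c ^ 2 / 2 * (((n : ℝ) - γ.card) + ((m : ℝ) - γ.card)))}

/-- The assignment sets between a singleton and a singleton are `∅` and the full one, so the
distance is the truncated base distance. -/
theorem gospa_singleton {k : ℕ} {c : ℝ} (hc : 0 ≤ c) (x y : EuclideanSpace ℝ (Fin k)) :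
    gospa c (fun _ : Fin 1 => x) (fun _ : Fin 1 => y) = min ‖x - y‖ c := by
  have hset : {d : ℝ | ∃ γ : Finset (Fin 1 × Fin 1),
      ((∀ p ∈ γ, ∀ q ∈ γ, p.1 = q.1 → p.2 = q.2) ∧
       (∀ p ∈ γ, ∀ q ∈ γ, p.2 = q.2 → p.1 = q.1)) ∧
      d = Real.sqrt ((∑ p ∈ γ, ‖x - y‖ ^ 2) +
          c ^ 2 / 2 * ((((1 : ℕ) : ℝ) - γ.card) + (((1 : ℕ) : ℝ) - γ.card)))} =
      {‖x - y‖, c} := by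
    have h_empty : √(c ^ 2 / 2 * (1 + 1)) = c := by
      rw [show c ^ 2 / 2 * (1 + 1) = c ^ 2 by ring, Real.sqrt_sq hc]
    ext d
    simp only [Set.mem_ofPred_eq, Set.mem_insert_iff, Set.mem_singleton_iff]
    constructor
    · rintro ⟨γ, -, rfl⟩
      rcases γ.eq_empty_or_nonempty with rfl | hγ
      · right
        simpa using h_empty
      · left
        obtain rfl : γ = {default} := hγ.subset_singleton_iff.mp fun a _ => by
          simp [Subsingleton.elim a default]
        simp
    · rintro (rfl | rfl)
      · exact ⟨{default}, by simp, by simp⟩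
      · exact ⟨∅, by simp, by simpa using h_empty.symm⟩
  rw [gospa, hset, csInf_pair]

/-- Against the empty set only the empty assignment is available. -/
theorem gospa_empty_singleton_sq {k : ℕ} (c : ℝ) (x : Fin 0 → EuclideanSpace ℝ (Fin k))
    (y : EuclideanSpace ℝ (Fin k)) :
    gospa c x (fun _ : Fin 1 => y) ^ 2 = c ^ 2 / 2 := by
  have hset : {d : ℝ | ∃ γ : Finset (Fin 0 × Fin 1),
      ((∀ p ∈ γ, ∀ q ∈ γ, p.1 = q.1 → p.2 = q.2) ∧
       (∀ p ∈ γ, ∀ q ∈ γ, p.2 = q.2 → p.1 = q.1)) ∧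
      d = Real.sqrt ((∑ p ∈ γ, ‖x p.1 - y‖ ^ 2) +
          c ^ 2 / 2 * ((((0 : ℕ) : ℝ) - γ.card) + (((1 : ℕ) : ℝ) - γ.card)))} =
      {√(c ^ 2 / 2)} := by
    ext d
    simp only [Set.mem_ofPred_eq, Set.mem_singleton_iff]
    constructor
    · rintro ⟨γ, -, rfl⟩
      obtain rfl : γ = ∅ := Finset.eq_empty_of_isEmpty γ
      simp
    · rintro rfl
      exact ⟨∅, by simp, by simp⟩
  rw [gospa, hset, csInf_singleton, Real.sq_sqrt (by positivity)]

/-- With hypothesis probabilities `p 0, p 1, …, p n` (nonnegative, summing to 1, `p 0 < 1`),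
hypotheses `X₀ = ∅` and `Xᵢ = {x i}` for `i ≥ 1`, weights `wᵢ = pᵢ/(1 − p₀)` and
truncated weights `w̲ᵢ = wᵢ` if `‖xᵢ − x̂‖ ≤ c` and `0` otherwise, the mean squared GOSPA
error of the point estimate `{x̂}` satisfies
`∑_{i=0}^{n} pᵢ · [gospa(Xᵢ, {x̂})]²
  = (c²/2)·p₀ + (1 − p₀)·( ∑ᵢ w̲ᵢ‖xᵢ − x̂‖² + c²(1 − ∑ᵢ w̲ᵢ) )`. -/
theorem ms_gospa_point_estimate (k n : ℕ) (c : ℝ) (hc : 0 < c)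
    (p : Fin (n + 1) → ℝ) (hp : ∀ i, 0 ≤ p i) (hsum : ∑ i, p i = 1) (hp0 : p 0 < 1)
    (x : Fin n → EuclideanSpace ℝ (Fin k)) (xhat : EuclideanSpace ℝ (Fin k))
    (w wbar : Fin n → ℝ)
    (hw : ∀ i, w i = p i.succ / (1 - p 0))
    (hwbar : ∀ i, wbar i = if ‖x i - xhat‖ ≤ c then w i else 0) :
    p 0 * (gospa c (Fin.elim0 : Fin 0 → EuclideanSpace ℝ (Fin k))
            (fun _ : Fin 1 => xhat)) ^ 2 +
      ∑ i : Fin n, p i.succ *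
        (gospa c (fun _ : Fin 1 => x i) (fun _ : Fin 1 => xhat)) ^ 2
    = c ^ 2 / 2 * p 0 +
        (1 - p 0) * ((∑ i, wbar i * ‖x i - xhat‖ ^ 2) + c ^ 2 * (1 - ∑ i, wbar i)) := by
  have h_ne : 1 - p 0 ≠ 0 := (sub_pos.mpr hp0).ne'
  have h_mass : 1 - p 0 = ∑ i : Fin n, p i.succ := by
    rw [← hsum, Fin.sum_univ_succ]
    ring
  have h_term : ∀ i, p i.succ * min ‖x i - xhat‖ c ^ 2 =
      (1 - p 0) * (wbar i * ‖x i - xhat‖ ^ 2) +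
        (c ^ 2 * p i.succ - c ^ 2 * ((1 - p 0) * wbar i)) := by
    intro i
    rw [hwbar, hw]
    split_ifs with h
    · rw [min_eq_left h]
      field_simp
      ring
    · rw [min_eq_right (not_le.mp h).le]
      ring
  simp only [gospa_empty_singleton_sq, gospa_singleton hc.le, h_term]
  rw [Finset.sum_add_distrib, Finset.sum_sub_distrib, ← Finset.mul_sum, ← Finset.mul_sum,
    ← Finset.mul_sum, ← Finset.mul_sum, ← h_mass]
  ring
end

section
/- Fix T ≥ 1, a discount factor λ ≥ 0, nonempty finite action types A₁, …, A_T and finite measurement types Z₁, …, Z_T each with a distinguished null element φ_t ∈ Z_t, measurement kernels p_t assigning to each history of actions (a₁,…,a_t) and past measurements (z₁,…,z_{t−1}) a probability mass function on Z_t, and nonnegative cost functions r_t : (A₁×⋯×A_t) × (Z₁×⋯×Z_t) → ℝ. Suppose that for every t, r_t(a_{1:t}, z_{1:t}) = 0 unless z_j = φ_j for all j = 1, …, t (the cost at time t vanishes as soon as any earlier or current measurement is non-null). Then the open-loop value V* (the minimum over all action tuples of the expected discounted sum of costs) equals the closed-loop Bellman value V̂* (defined by the backward recursion in which each action may depend on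 the realised earlier measurements). In particular, the first actions selected by the suboptimal open-loop approach and by the optimal closed-loop approach yield the same optimal cost. -/
/-- The probability, under the measurement kernels `p`, of the full measurement sequence
`z` when the full action tuple `a` is used: `∏_{t<T} p_t(z_t | z_{1:t-1}; a_{1:t})`. -/
def jointMeasProb {T : ℕ} {A Z : ℕ → Type}
    (p : (t : ℕ) → ((s : Fin (t + 1)) → A s) → ((s : Fin t) → Z s) → Z t → ℝ)
    (a : (s : Fin T) → A s) (z : (s : Fin T) → Z s) : ℝ :=
  ∏ t : Fin T,
    p t (fun s => a (Fin.castLE t.isLt s)) (fun s => z (Fin.castLE t.isLt.le s)) (z t)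

/-- The expected (under the joint measurement distribution induced by the kernels `p`)
discounted sum of costs `∑_{t<T} λ^t r_t(a_{1:t}, z_{1:t})` for a fixed (open-loop)
action tuple `a`. -/
noncomputable def openLoopCost {T : ℕ} {A Z : ℕ → Type} [∀ t, Fintype (Z t)] (lam : ℝ)
    (p : (t : ℕ) → ((s : Fin (t + 1)) → A s) → ((s : Fin t) → Z s) → Z t → ℝ)
    (r : (t : ℕ) → ((s : Fin (t + 1)) → A s) → ((s : Fin (t + 1)) → Z s) → ℝ)
    (a : (s : Fin T) → A s) : ℝ :=
  ∑ z : (s : Fin T) → Z s,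
    jointMeasProb p a z *
      ∑ t : Fin T, lam ^ (t : ℕ) *
        r t (fun s => a (Fin.castLE t.isLt s)) (fun s => z (Fin.castLE t.isLt s))

/-- Backward Bellman recursion for the closed-loop value: `closedLoopValue T lam p r d t h a z`
is the optimal cost-to-go from time `t` (with `d = T - t` remaining steps), given realised
action history `a` and measurement history `z`; at each step the action `a_t` is chosen to
minimise the conditional expectation of the current discounted cost `λ^t r_t` plus the
continuation value. -/
noncomputable def closedLoopValue (T : ℕ) {A Z : ℕ → Type}
    [∀ t, Fintype (A t)] [∀ t, Nonempty (A t)] [∀ t, Fintype (Z t)] (lam : ℝ)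
    (p : (t : ℕ) → ((s : Fin (t + 1)) → A s) → ((s : Fin t) → Z s) → Z t → ℝ)
    (r : (t : ℕ) → ((s : Fin (t + 1)) → A s) → ((s : Fin (t + 1)) → Z s) → ℝ) :
    (d : ℕ) → (t : ℕ) → t + d = T → ((s : Fin t) → A s) → ((s : Fin t) → Z s) → ℝ
  | 0, _, _, _, _ => 0
  | d + 1, t, h, a, z =>
      ⨅ at' : A t, ∑ zt : Z t,
        p t (Fin.snoc a at') z zt *
          (lam ^ t * r t (Fin.snoc a at') (Fin.snoc z zt) +
            closedLoopValue T lam p r d (t + 1) (by omega) (Fin.snoc a at') (Fin.snoc z zt))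

section NullBranch

variable {A Z : ℕ → Type}

lemma Fin.snoc_restrict {X : ℕ → Type} (x : (s : ℕ) → X s) (n : ℕ) :
    (Fin.snoc (α := fun s : Fin (n + 1) => X s) (fun s : Fin n => x s) (x n)) =
      fun s : Fin (n + 1) => x s := by
  funext s
  refine Fin.lastCases ?_ (fun i => ?_) s
  · exact Fin.snoc_last (α := fun s : Fin (n + 1) => X s) _ _
  · exact Fin.snoc_castSucc (α := fun s : Fin (n + 1) => X s) _ _ i

lemma Fin.snoc_ne_of_ne {X : ℕ → Type} (φ : (s : ℕ) → X s) {n : ℕ}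
    {x : (s : Fin n) → X s} (hx : ¬ ∀ j, x j = φ j) (y : X n) :
    ¬ ∀ j : Fin (n + 1), Fin.snoc (α := fun s : Fin (n + 1) => X s) x y j = φ j := by
  intro h
  refine hx fun j => ?_
  have h' := h j.castSucc
  rwa [Fin.snoc_castSucc (α := fun s : Fin (n + 1) => X s)] at h'

lemma Fin.snoc_ne_of_last_ne {X : ℕ → Type} (φ : (s : ℕ) → X s) {n : ℕ}
    (x : (s : Fin n) → X s) {y : X n} (hy : y ≠ φ n) :
    ¬ ∀ j : Fin (n + 1), Fin.snoc (α := fun s : Fin (n + 1) => X s) x y j = φ j := by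
  intro h
  have h' := h (Fin.last n)
  rw [Fin.snoc_last (α := fun s : Fin (n + 1) => X s)] at h'
  exact hy h'

/-- The cost-to-go of the action sequence `a` over the `d` steps from time `t` on, along the
branch on which all measurements are null. -/
def nullBranchCost (lam : ℝ) (φ : (t : ℕ) → Z t)
    (p : (t : ℕ) → ((s : Fin (t + 1)) → A s) → ((s : Fin t) → Z s) → Z t → ℝ)
    (r : (t : ℕ) → ((s : Fin (t + 1)) → A s) → ((s : Fin (t + 1)) → Z s) → ℝ)
    (a : (s : ℕ) → A s) : ℕ → ℕ → ℝ
  | 0, _ => 0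
  | d + 1, t =>
      p t (fun s => a s) (fun s => φ s) (φ t) *
        (lam ^ t * r t (fun s => a s) (fun s => φ s) + nullBranchCost lam φ p r a d (t + 1))

variable (lam : ℝ) (φ : (t : ℕ) → Z t)
  (p : (t : ℕ) → ((s : Fin (t + 1)) → A s) → ((s : Fin t) → Z s) → Z t → ℝ)
  (r : (t : ℕ) → ((s : Fin (t + 1)) → A s) → ((s : Fin (t + 1)) → Z s) → ℝ)

lemma jointMeasProb_snoc (a : (s : ℕ) → A s) (n : ℕ) (z : (s : Fin n) → Z s) (y : Z n) :
    jointMeasProb p (fun s : Fin (n + 1) => a s)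
        (Fin.snoc (α := fun s : Fin (n + 1) => Z s) z y) =
      jointMeasProb p (fun s : Fin n => a s) z * p n (fun s => a s) z y := by
  have hsnoc (i : Fin n) :
      Fin.snoc (α := fun s : Fin (n + 1) => Z s) z y i.castSucc = z i :=
    Fin.snoc_castSucc (α := fun s : Fin (n + 1) => Z s) _ _ i
  unfold jointMeasProb
  rw [Fin.prod_univ_castSucc]
  congr 1
  · refine Finset.prod_congr rfl fun t _ => ?_
    have h : (fun s : Fin t => Fin.snoc (α := fun s : Fin (n + 1) => Z s) z y
        (Fin.castLE t.castSucc.isLt.le s)) = fun s => z (Fin.castLE t.isLt.le s) :=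
      funext fun s => hsnoc (Fin.castLE t.isLt.le s)
    exact congrArg₂ (p t (fun s => a s)) h (hsnoc t)
  · have h : (fun s : Fin n => Fin.snoc (α := fun s : Fin (n + 1) => Z s) z y
        (Fin.castLE (Fin.last n).isLt.le s)) = z := funext fun s => hsnoc s
    exact congrArg₂ (p n (fun s => a s)) h
      (Fin.snoc_last (α := fun s : Fin (n + 1) => Z s) _ _)

variable [∀ t, Fintype (Z t)]

lemma openLoopCost_succ
    (hp : ∀ t a z, (∀ zt, 0 ≤ p t a z zt) ∧ ∑ zt, p t a z zt = 1)
    (hnull : ∀ (t : ℕ) (a : (s : Fin (t + 1)) → A s) (z : (s : Fin (t + 1)) → Z s),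
      ¬ (∀ j : Fin (t + 1), z j = φ j) → r t a z = 0)
    (a : (s : ℕ) → A s) (n : ℕ) :
    openLoopCost lam p r (fun s : Fin (n + 1) => a s) =
      openLoopCost lam p r (fun s : Fin n => a s) +
        jointMeasProb p (fun s : Fin (n + 1) => a s) (fun s => φ s) *
          (lam ^ n * r n (fun s => a s) (fun s => φ s)) := by
  have hcost (z : (s : Fin n) → Z s) (y : Z n) :
      (∑ t : Fin (n + 1), lam ^ (t : ℕ) * r t (fun s => a s) (fun s =>
        Fin.snoc (α := fun s : Fin (n + 1) => Z s) z y (Fin.castLE t.isLt s))) =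
      (∑ t : Fin n, lam ^ (t : ℕ) * r t (fun s => a s) (fun s => z (Fin.castLE t.isLt s))) +
        lam ^ n * r n (fun s => a s) (Fin.snoc z y) := by
    rw [Fin.sum_univ_castSucc]
    congr 1
    refine Finset.sum_congr rfl fun t _ => ?_
    have h : (fun s : Fin (t + 1) => Fin.snoc (α := fun s : Fin (n + 1) => Z s) z y
        (Fin.castLE t.castSucc.isLt s)) = fun s => z (Fin.castLE t.isLt s) :=
      funext fun s =>
        Fin.snoc_castSucc (α := fun s : Fin (n + 1) => Z s) _ _ (Fin.castLE t.isLt s)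
    exact congrArg (fun w => lam ^ (t : ℕ) * r t (fun s => a s) w) h
  have hlast : (∑ z : (s : Fin (n + 1)) → Z s, jointMeasProb p (fun s => a s) z *
      (lam ^ n * r n (fun s => a s) z)) =
      jointMeasProb p (fun s : Fin (n + 1) => a s) (fun s => φ s) *
          (lam ^ n * r n (fun s => a s) (fun s => φ s)) := by
    refine Finset.sum_eq_single _ (fun z _ hz => ?_) (fun h => absurd (Finset.mem_univ _) h)
    rw [hnull n _ z fun h => hz (funext h), mul_zero, mul_zero]
  rw [← hlast]
  unfold openLoopCost
  rw [← (Fin.snocEquiv (fun s : Fin (n + 1) => Z s)).sum_comp,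
    ← (Fin.snocEquiv (fun s : Fin (n + 1) => Z s)).sum_comp, Fintype.sum_prod_type_right,
    Fintype.sum_prod_type_right]
  refine Eq.trans ?_ Finset.sum_add_distrib
  refine Finset.sum_congr rfl fun z _ => ?_
  have hmean (c e : ℝ) : c * e = ∑ y, c * p n (fun s => a s) z y * e := by
    rw [← Finset.sum_mul, ← Finset.mul_sum, (hp n (fun s => a s) z).2, mul_one]
  refine Eq.trans ?_ (congrArg (· + _) (hmean _ _).symm)
  refine Eq.trans ?_ Finset.sum_add_distrib
  refine Finset.sum_congr rfl fun y _ => ?_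
  have h₁ := hcost z y
  have h₂ := jointMeasProb_snoc p a n z y
  change jointMeasProb p _ (Fin.snoc (α := fun s : Fin (n + 1) => Z s) z y) * _ = _ +
    jointMeasProb p _ (Fin.snoc (α := fun s : Fin (n + 1) => Z s) z y) * _
  rw [h₂, ← mul_add]
  exact congrArg _ h₁

lemma openLoopCost_add
    (hp : ∀ t a z, (∀ zt, 0 ≤ p t a z zt) ∧ ∑ zt, p t a z zt = 1)
    (hnull : ∀ (t : ℕ) (a : (s : Fin (t + 1)) → A s) (z : (s : Fin (t + 1)) → Z s),
      ¬ (∀ j : Fin (t + 1), z j = φ j) → r t a z = 0)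
    (a : (s : ℕ) → A s) {T : ℕ} (d n : ℕ) (h : n + d = T) :
    openLoopCost lam p r (fun s : Fin T => a s) =
      openLoopCost lam p r (fun s : Fin n => a s) +
        jointMeasProb p (fun s : Fin n => a s) (fun s => φ s) *
          nullBranchCost lam φ p r a d n := by
  induction d generalizing n with
  | zero =>
    subst h
    simp [nullBranchCost]
  | succ d ih =>
    have hprob := jointMeasProb_snoc p a n (fun s => φ s) (φ n)
    rw [Fin.snoc_restrict φ n] at hprob
    rw [ih (n + 1) (by omega), openLoopCost_succ lam φ p r hp hnull, hprob,
      nullBranchCost]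
    ring

lemma openLoopCost_eq_nullBranchCost
    (hp : ∀ t a z, (∀ zt, 0 ≤ p t a z zt) ∧ ∑ zt, p t a z zt = 1)
    (hnull : ∀ (t : ℕ) (a : (s : Fin (t + 1)) → A s) (z : (s : Fin (t + 1)) → Z s),
      ¬ (∀ j : Fin (t + 1), z j = φ j) → r t a z = 0)
    (a : (s : ℕ) → A s) (T : ℕ) :
    openLoopCost lam p r (fun s : Fin T => a s) = nullBranchCost lam φ p r a T 0 := by
  rw [openLoopCost_add lam φ p r hp hnull a T 0 (Nat.zero_add T)]
  simp [openLoopCost, jointMeasProb]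

variable [∀ t, Fintype (A t)] [∀ t, Nonempty (A t)]

lemma closedLoopValue_eq_zero
    (hnull : ∀ (t : ℕ) (a : (s : Fin (t + 1)) → A s) (z : (s : Fin (t + 1)) → Z s),
      ¬ (∀ j : Fin (t + 1), z j = φ j) → r t a z = 0)
    {T : ℕ} (d t : ℕ) (h : t + d = T) (a : (s : Fin t) → A s)
    (z : (s : Fin t) → Z s) (hz : ¬ ∀ j, z j = φ j) :
    closedLoopValue T lam p r d t h a z = 0 := by
  induction d generalizing t with
  | zero => rfl
  | succ d ih =>
    have hstep (x : A t) (y : Z t) :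
        p t (Fin.snoc a x) z y * (lam ^ t * r t (Fin.snoc a x) (Fin.snoc z y) +
          closedLoopValue T lam p r d (t + 1) (by omega) (Fin.snoc a x) (Fin.snoc z y)) = 0 := by
      have hzy := Fin.snoc_ne_of_ne φ hz y
      rw [hnull t _ _ hzy, ih (t + 1) _ _ _ hzy]
      ring
    simp only [closedLoopValue, hstep, Finset.sum_const_zero, ciInf_const]

lemma closedLoopValue_succ_null
    (hnull : ∀ (t : ℕ) (a : (s : Fin (t + 1)) → A s) (z : (s : Fin (t + 1)) → Z s),
      ¬ (∀ j : Fin (t + 1), z j = φ j) → r t a z = 0)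
    {T : ℕ} (d t : ℕ) (h : t + (d + 1) = T)
    (a : (s : Fin t) → A s) :
    closedLoopValue T lam p r (d + 1) t h a (fun s => φ s) =
      ⨅ x : A t, p t (Fin.snoc a x) (fun s => φ s) (φ t) *
        (lam ^ t * r t (Fin.snoc a x) (fun s => φ s) +
          closedLoopValue T lam p r d (t + 1) (by omega) (Fin.snoc a x) (fun s => φ s)) := by
  rw [closedLoopValue]
  refine iInf_congr fun x => ?_
  rw [Finset.sum_eq_single (φ t), Fin.snoc_restrict φ t]
  · intro y _ hy
    have hzy := Fin.snoc_ne_of_last_ne φ (fun s : Fin t => φ s) hy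
    rw [hnull t _ _ hzy, closedLoopValue_eq_zero lam φ p r hnull _ _ _ _ _ hzy]
    ring
  · exact fun h => absurd (Finset.mem_univ _) h

lemma closedLoopValue_le_nullBranchCost
    (hp : ∀ t a z, (∀ zt, 0 ≤ p t a z zt) ∧ ∑ zt, p t a z zt = 1)
    (hnull : ∀ (t : ℕ) (a : (s : Fin (t + 1)) → A s) (z : (s : Fin (t + 1)) → Z s),
      ¬ (∀ j : Fin (t + 1), z j = φ j) → r t a z = 0)
    {T : ℕ} (a : (s : ℕ) → A s) (d t : ℕ)
    (h : t + d = T) :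
    closedLoopValue T lam p r d t h (fun s => a s) (fun s => φ s) ≤
      nullBranchCost lam φ p r a d t := by
  induction d generalizing t with
  | zero => exact le_rfl
  | succ d ih =>
    rw [closedLoopValue_succ_null lam φ p r hnull, nullBranchCost]
    refine (ciInf_le (Set.finite_range _).bddBelow (a t)).trans ?_
    rw [Fin.snoc_restrict a t]
    exact mul_le_mul_of_nonneg_left (by gcongr; exact ih (t + 1) (by omega)) ((hp _ _ _).1 _)

lemma exists_nullBranchCost_eq_closedLoopValue
    (hnull : ∀ (t : ℕ) (a : (s : Fin (t + 1)) → A s) (z : (s : Fin (t + 1)) → Z s),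
      ¬ (∀ j : Fin (t + 1), z j = φ j) → r t a z = 0)
    {T : ℕ} (d t : ℕ) (h : t + d = T)
    (a : (s : ℕ) → A s) :
    ∃ b : (s : ℕ) → A s, (∀ s < t, b s = a s) ∧
      nullBranchCost lam φ p r b d t =
        closedLoopValue T lam p r d t h (fun s => a s) (fun s => φ s) := by
  induction d generalizing t a with
  | zero => exact ⟨a, fun _ _ => rfl, rfl⟩
  | succ d ih =>
    rw [closedLoopValue_succ_null lam φ p r hnull]
    obtain ⟨x, hx⟩ := exists_eq_ciInf_of_finite (f := fun x : A t =>
      p t (Fin.snoc (fun s : Fin t => a s) x) (fun s => φ s) (φ t) *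
        (lam ^ t * r t (Fin.snoc (fun s : Fin t => a s) x) (fun s => φ s) +
          closedLoopValue T lam p r d (t + 1) (by omega)
            (Fin.snoc (fun s : Fin t => a s) x) (fun s => φ s)))
    obtain ⟨b, hb, hval⟩ := ih (t + 1) (by omega) (Function.update a t x)
    have hba : ∀ s < t, b s = a s := fun s hs => by
      rw [hb s (by omega), Function.update_of_ne hs.ne]
    have hbt : b t = x := by rw [hb t (by omega), Function.update_self]
    have hupd : (fun s : Fin (t + 1) => Function.update a t x s) = fun s : Fin (t + 1) => b s :=
      funext fun s => (hb s s.isLt).symm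
    have hsnoc : Fin.snoc (α := fun s : Fin (t + 1) => A s) (fun s : Fin t => a s) x =
        fun s : Fin (t + 1) => b s := by
      rw [← Fin.snoc_restrict b t, hbt, funext fun s : Fin t => hba s s.isLt]
    refine ⟨b, hba, ?_⟩
    rw [← hx, nullBranchCost, hval, hupd, hsnoc]

end NullBranch

/-- Ideal-measurement-set case (error-free measurements, no false alarms, missed
detections allowed): if each `Z t` has a distinguished null measurement `φ t`, the costs
`r_t` are nonnegative, and `r_t(a_{1:t}, z_{1:t}) = 0` unless `z_j = φ_j` for all
`j = 1,…,t`, then the optimal open-loop value `V*` equals the optimal closed-loop Bellman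
value `V̂*`; in particular the suboptimal open-loop and optimal closed-loop approaches
yield the same optimal cost. -/
theorem openLoop_eq_closedLoop_of_null_support (T : ℕ) (hT : 1 ≤ T)
    (lam : ℝ) (hlam : 0 ≤ lam)
    (A Z : ℕ → Type) [∀ t, Fintype (A t)] [∀ t, Nonempty (A t)] [∀ t, Fintype (Z t)]
    (φ : (t : ℕ) → Z t)
    (p : (t : ℕ) → ((s : Fin (t + 1)) → A s) → ((s : Fin t) → Z s) → Z t → ℝ)
    (hp : ∀ t a z, (∀ zt, 0 ≤ p t a z zt) ∧ ∑ zt, p t a z zt = 1)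
    (r : (t : ℕ) → ((s : Fin (t + 1)) → A s) → ((s : Fin (t + 1)) → Z s) → ℝ)
    (hr : ∀ t a z, 0 ≤ r t a z)
    (hnull : ∀ (t : ℕ) (a : (s : Fin (t + 1)) → A s) (z : (s : Fin (t + 1)) → Z s),
      ¬ (∀ j : Fin (t + 1), z j = φ j) → r t a z = 0) :
    (⨅ a : (s : Fin T) → A s, openLoopCost lam p r a)
      = closedLoopValue T lam p r T 0 (by omega) (fun s => s.elim0) (fun s => s.elim0) := by
  have hz : (fun s : Fin 0 => (s.elim0 : Z s)) = fun s : Fin 0 => φ s :=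
    funext fun s => s.elim0
  have ha (a : (s : ℕ) → A s) : (fun s : Fin 0 => (s.elim0 : A s)) =
      fun s : Fin 0 => a s :=
    funext fun s => s.elim0
  apply le_antisymm
  · obtain ⟨b, -, hb⟩ := exists_nullBranchCost_eq_closedLoopValue lam φ p r hnull T 0
      (Nat.zero_add T) (fun _ => Classical.arbitrary _)
    rw [hz, ha fun _ => Classical.arbitrary _, ← hb,
      ← openLoopCost_eq_nullBranchCost lam φ p r hp hnull]
    exact ciInf_le (Set.finite_range _).bddBelow (fun s : Fin T => b s)
  · refine le_ciInf fun a => ?_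
    let b : (s : ℕ) → A s := fun s =>
      if h : s < T then a ⟨s, h⟩ else Classical.arbitrary _
    have hab : a = fun s : Fin T => b s := funext fun s => by simp [b]
    rw [hab, openLoopCost_eq_nullBranchCost lam φ p r hp hnull, hz, ha b]
    exact closedLoopValue_le_nullBranchCost lam φ p r hp hnull b T 0 (Nat.zero_add T)
end
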